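/- (Combinatorial form of the Proposition on 𝐡_Λ, including the inductive claim in its proof.) Let h = (m_1,…,m_N) ∈ ℋ_𝐢 with m_k ≥ 0 for every k. Then for every 1 ≤ k ≤ N, f̃_{i_k}^{m_k} f̃_{i_{k+1}}^{m_{k+1}} ⋯ f̃_{i_N}^{m_N}(0,…,0) = (0,…,0, m_k, m_{k+1},…, m_N) (the vector whose first k − 1 coordinates vanish and whose coordinate at position l is m_l for l ≥ k); in particular f̃_{i_1}^{m_1} f̃_{i_2}^{m_2} ⋯ f̃_{i_N}^{m_N}(0,…,0) = h. -/

import Mathlib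

/-- `σ_k(x) = x_k + Σ_{j<k} a_{i_k i_j} x_j` on the cellular crystal `𝔹_𝐢 ≅ ℤ^N`. -/
def sig {n N : ℕ} (A : Fin n → Fin n → ℤ) (ii : Fin N → Fin n)
    (x : Fin N → ℤ) (k : Fin N) : ℤ :=
  x k + ∑ j ∈ Finset.univ.filter (fun j => j < k), A (ii k) (ii j) * x j

/-- `l = k⁺`: the least index `l > k` with the same color `i_l = i_k`. -/
def IsKPlus {n N : ℕ} (ii : Fin N → Fin n) (k l : Fin N) : Prop :=
  k < l ∧ ii l = ii k ∧ ∀ j : Fin N, k < j → ii j = ii k → l ≤ j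

/-- `β_k(x) = x_k + Σ_{k<j<k⁺} a_{i_k i_j} x_j + x_{k⁺}` (with `l = k⁺`). -/
def betaFn {n N : ℕ} (A : Fin n → Fin n → ℤ) (ii : Fin N → Fin n)
    (x : Fin N → ℤ) (k l : Fin N) : ℤ :=
  x k + ∑ j ∈ Finset.univ.filter (fun j => k < j ∧ j < l), A (ii k) (ii j) * x j + x l

/-- `ℋ_𝐢 = {h ∈ ℤ^N : β_k(h) = 0 whenever k⁺ exists}`. -/
def Hset {n N : ℕ} (A : Fin n → Fin n → ℤ) (ii : Fin N → Fin n) : Set (Fin N → ℤ) :=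
  {h | ∀ k l : Fin N, IsKPlus ii k l → betaFn A ii h k l = 0}

/-- The set of positions of color `i` in the word `𝐢`. -/
def occ {n N : ℕ} (ii : Fin N → Fin n) (i : Fin n) : Finset (Fin N) :=
  Finset.univ.filter (fun k => ii k = i)

/-- `σ̃_i(x) = max{σ_k(x) : i_k = i}` (junk value `0` if `i` does not occur in `𝐢`). -/
def sigTilde {n N : ℕ} (A : Fin n → Fin n → ℤ) (ii : Fin N → Fin n)
    (i : Fin n) (x : Fin N → ℤ) : ℤ :=
  if h : (occ ii i).Nonempty then (occ ii i).sup' h (sig A ii x) else 0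

/-- The set of positions `k` of color `i` where `σ_k(x)` attains the maximum `σ̃_i(x)`. -/
def Mset {n N : ℕ} (A : Fin n → Fin n → ℤ) (ii : Fin N → Fin n)
    (i : Fin n) (x : Fin N → ℤ) : Finset (Fin N) :=
  (occ ii i).filter (fun k => sig A ii x k = sigTilde A ii i x)

/-- The Kashiwara operator `f̃_i` on `𝔹_𝐢 ≅ ℤ^N`: add `1` at position `m̃ᶠ_i(x)`,
the largest maximizer of `σ` among positions of color `i`. -/
def ftilde {n N : ℕ} (A : Fin n → Fin n → ℤ) (ii : Fin N → Fin n)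
    (i : Fin n) (x : Fin N → ℤ) : Fin N → ℤ :=
  if h : (Mset A ii i x).Nonempty then
    Function.update x ((Mset A ii i x).max' h) (x ((Mset A ii i x).max' h) + 1)
  else x

/-- The Kashiwara operator `ẽ_i` on `𝔹_𝐢 ≅ ℤ^N`: subtract `1` at position `m̃ᵉ_i(x)`,
the smallest maximizer of `σ` among positions of color `i`. -/
def etilde {n N : ℕ} (A : Fin n → Fin n → ℤ) (ii : Fin N → Fin n)
    (i : Fin n) (x : Fin N → ℤ) : Fin N → ℤ :=
  if h : (Mset A ii i x).Nonempty then
    Function.update x ((Mset A ii i x).min' h) (x ((Mset A ii i x).min' h) - 1)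
  else x

/-- `chainAux A ii m t` is the result of applying, to the zero vector, the Kashiwara
operators `f̃_{i_{N-t+1}}^{m_{N-t+1}}, …, f̃_{i_N}^{m_N}` (1-based; innermost is
`f̃_{i_N}^{m_N}`); i.e. it represents `f̃_{i_{k}}^{m_{k}} ⋯ f̃_{i_N}^{m_N}(0,…,0)`
for `k = N − t + 1`. -/
def chainAux {n N : ℕ} (A : Fin n → Fin n → ℤ) (ii : Fin N → Fin n)
    (m : Fin N → ℕ) : ℕ → (Fin N → ℤ)
  | 0 => fun _ => 0
  | t + 1 =>
    if h : t < N then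
      (ftilde A ii (ii ⟨N - 1 - t, by omega⟩))^[m ⟨N - 1 - t, by omega⟩]
        (chainAux A ii m t)
    else chainAux A ii m t

lemma sig_eq_sig_add_betaFn {n N : ℕ} {A : Fin n → Fin n → ℤ} (hA2 : ∀ p, A p p = 2)
    {ii : Fin N → Fin n} {k l : Fin N} (hkl : IsKPlus ii k l) (x : Fin N → ℤ) :
    sig A ii x l = sig A ii x k + betaFn A ii x k l := by
  obtain ⟨hlt, hc, -⟩ := hkl
  have hsplit : Finset.univ.filter (fun j : Fin N => j < l) =
      insert k (Finset.univ.filter (fun j => j < k) ∪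
        Finset.univ.filter (fun j => k < j ∧ j < l)) := by
    ext j
    simp only [Finset.mem_filter, Finset.mem_univ, true_and, Finset.mem_insert, Finset.mem_union]
    omega
  have hdisj : Disjoint (Finset.univ.filter (fun j : Fin N => j < k))
      (Finset.univ.filter (fun j => k < j ∧ j < l)) := by
    rw [Finset.disjoint_filter]
    intro j _ h1 h2
    exact lt_asymm h1 h2.1
  rw [sig, hsplit, Finset.sum_insert (by simp), Finset.sum_union hdisj, hc, hA2, sig, betaFn]
  ring

/-- Every position with an earlier one of the same color is the successor of some position. -/
lemma exists_isKPlus_of_lt {n N : ℕ} {ii : Fin N → Fin n} {k j : Fin N}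
    (hkj : k < j) (hc : ii j = ii k) : ∃ p, k ≤ p ∧ ii p = ii k ∧ IsKPlus ii p j := by
  have hne : (Finset.univ.filter (fun q : Fin N => q < j ∧ ii q = ii k)).Nonempty :=
    ⟨k, by simp [hkj]⟩
  obtain ⟨p, hp, hmax⟩ := Finset.exists_max_image _ id hne
  simp only [Finset.mem_filter, Finset.mem_univ, true_and, id] at hp hmax
  refine ⟨p, hmax k ⟨hkj, rfl⟩, hp.2, hp.1, hc.trans hp.2.symm, fun q hpq hq => ?_⟩
  by_contra! hlt
  exact absurd (hmax q ⟨hlt, hq.trans hp.2⟩) (not_le.mpr hpq)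

lemma sig_lt_sig_of_betaFn {n N : ℕ} {A : Fin n → Fin n → ℤ} (hA2 : ∀ p, A p p = 2)
    {ii : Fin N → Fin n} {x : Fin N → ℤ} {k : Fin N}
    (hk : ∀ l, IsKPlus ii k l → betaFn A ii x k l < 0)
    (hgt : ∀ p l, k < p → IsKPlus ii p l → betaFn A ii x p l ≤ 0)
    (j : Fin N) (hkj : k < j) (hc : ii j = ii k) : sig A ii x j < sig A ii x k := by
  induction j using WellFoundedLT.induction with
  | ind j ih =>
    obtain ⟨p, hkp, hpc, hp⟩ := exists_isKPlus_of_lt hkj hc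
    rw [sig_eq_sig_add_betaFn hA2 hp]
    rcases hkp.eq_or_lt with rfl | hlt
    · linarith [hk j hp]
    · linarith [ih p hp.1 hlt hpc, hgt p j hlt hp]

lemma ftilde_eq_update {n N : ℕ} {A : Fin n → Fin n → ℤ} {ii : Fin N → Fin n}
    {x : Fin N → ℤ} {k : Fin N}
    (hle : ∀ j < k, ii j = ii k → sig A ii x j ≤ sig A ii x k)
    (hlt : ∀ j, k < j → ii j = ii k → sig A ii x j < sig A ii x k) :
    ftilde A ii (ii k) x = Function.update x k (x k + 1) := by
  have hkocc : k ∈ occ ii (ii k) := by simp [occ]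
  have hsig : sigTilde A ii (ii k) x = sig A ii x k := by
    rw [sigTilde, dif_pos ⟨k, hkocc⟩]
    refine le_antisymm (Finset.sup'_le _ _ fun j hj => ?_) (Finset.le_sup' _ hkocc)
    have hj : ii j = ii k := by simpa [occ] using hj
    rcases lt_trichotomy j k with h | rfl | h
    · exact hle j h hj
    · exact le_rfl
    · exact (hlt j h hj).le
  have hkM : k ∈ Mset A ii (ii k) x := by simp [Mset, hkocc, hsig]
  have hmax : (Mset A ii (ii k) x).max' ⟨k, hkM⟩ = k := by
    refine le_antisymm (Finset.max'_le _ _ _ fun j hj => ?_) (Finset.le_max' _ _ hkM)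
    simp only [Mset, occ, Finset.mem_filter, Finset.mem_univ, true_and, hsig] at hj
    by_contra! hkj
    exact (hlt j hkj hj.1).ne hj.2
  rw [ftilde, dif_pos ⟨k, hkM⟩, hmax]

/-- The vector vanishing before position `k`, equal to `c` at `k` and to `h` after `k`. -/
def tailVec {N : ℕ} (h : Fin N → ℤ) (k : Fin N) (c : ℤ) : Fin N → ℤ :=
  fun l => if l < k then 0 else if l = k then c else h l

lemma sig_tailVec_of_lt {n N : ℕ} (A : Fin n → Fin n → ℤ) (ii : Fin N → Fin n)
    (h : Fin N → ℤ) {k j : Fin N} (c : ℤ) (hjk : j < k) :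
    sig A ii (tailVec h k c) j = 0 := by
  rw [sig, Finset.sum_eq_zero, tailVec, if_pos hjk, add_zero]
  intro q hq
  have hq : q < j := by simpa using hq
  rw [tailVec, if_pos (hq.trans hjk), mul_zero]

lemma sig_tailVec_self {n N : ℕ} (A : Fin n → Fin n → ℤ) (ii : Fin N → Fin n)
    (h : Fin N → ℤ) (k : Fin N) (c : ℤ) : sig A ii (tailVec h k c) k = c := by
  rw [sig, Finset.sum_eq_zero]
  · simp [tailVec]
  intro q hq
  have hq : q < k := by simpa using hq
  rw [tailVec, if_pos hq, mul_zero]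

lemma tailVec_of_gt {N : ℕ} (h : Fin N → ℤ) {k j : Fin N} (c : ℤ) (hkj : k < j) :
    tailVec h k c j = h j := by
  rw [tailVec, if_neg hkj.asymm, if_neg hkj.ne']

lemma betaFn_tailVec_of_gt {n N : ℕ} (A : Fin n → Fin n → ℤ) (ii : Fin N → Fin n)
    (h : Fin N → ℤ) {k p l : Fin N} (c : ℤ) (hkp : k < p) (hpl : p < l) :
    betaFn A ii (tailVec h k c) p l = betaFn A ii h p l := by
  rw [betaFn, betaFn, tailVec_of_gt h c hkp, tailVec_of_gt h c (hkp.trans hpl)]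
  congr 2
  refine Finset.sum_congr rfl fun q hq => ?_
  rw [tailVec_of_gt h c (hkp.trans (Finset.mem_filter.mp hq).2.1)]

lemma betaFn_tailVec_self {n N : ℕ} (A : Fin n → Fin n → ℤ) (ii : Fin N → Fin n)
    (h : Fin N → ℤ) {k l : Fin N} (c : ℤ) (hkl : k < l) :
    betaFn A ii (tailVec h k c) k l = betaFn A ii h k l - h k + c := by
  have hsum : ∑ j ∈ Finset.univ.filter (fun j => k < j ∧ j < l),
      A (ii k) (ii j) * tailVec h k c j =
      ∑ j ∈ Finset.univ.filter (fun j => k < j ∧ j < l), A (ii k) (ii j) * h j :=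
    Finset.sum_congr rfl fun q hq => by
      rw [tailVec_of_gt h c (Finset.mem_filter.mp hq).2.1]
  have hk : tailVec h k c k = c := by simp [tailVec]
  rw [betaFn, betaFn, hsum, hk, tailVec_of_gt h c hkl]
  ring

lemma ftilde_tailVec {n N : ℕ} {A : Fin n → Fin n → ℤ} (hA2 : ∀ p, A p p = 2)
    {ii : Fin N → Fin n} {h : Fin N → ℤ} (hH : h ∈ Hset A ii) {k : Fin N} {c : ℤ}
    (hc : 0 ≤ c) (hck : c < h k) :
    ftilde A ii (ii k) (tailVec h k c) = tailVec h k (c + 1) := by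
  rw [ftilde_eq_update]
  · ext l
    rcases eq_or_ne l k with rfl | hne
    · simp [tailVec]
    · simp [tailVec, hne]
  · intro j hjk _
    rwa [sig_tailVec_of_lt A ii h c hjk, sig_tailVec_self]
  · refine sig_lt_sig_of_betaFn hA2 (fun l hl => ?_) fun p l hkp hl => ?_
    · rw [betaFn_tailVec_self A ii h c hl.1, hH k l hl]
      linarith
    · rw [betaFn_tailVec_of_gt A ii h c hkp hl.1, hH p l hl]

lemma ftilde_iterate_tailVec {n N : ℕ} {A : Fin n → Fin n → ℤ} (hA2 : ∀ p, A p p = 2)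
    {ii : Fin N → Fin n} {h : Fin N → ℤ} (hH : h ∈ Hset A ii) {k : Fin N} (c : ℕ)
    (hck : (c : ℤ) ≤ h k) :
    (ftilde A ii (ii k))^[c] (tailVec h k 0) = tailVec h k c := by
  induction c with
  | zero => simp
  | succ c ih =>
    push_cast at hck ⊢
    rw [Function.iterate_succ_apply', ih (by linarith),
      ftilde_tailVec hA2 hH (by positivity) (by linarith)]

/-- combinatorial form of the Proposition on `𝐡_Λ`: if
`h = (m_1,…,m_N) ∈ ℋ_𝐢` has all coordinates nonnegative, then for every `0 ≤ t ≤ N`,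
`f̃_{i_{N-t+1}}^{m_{N-t+1}} ⋯ f̃_{i_N}^{m_N}(0,…,0)` is the vector whose coordinate at a
position `l` is `m_l` if `l` lies among the last `t` positions and `0` otherwise;
in particular `f̃_{i_1}^{m_1} ⋯ f̃_{i_N}^{m_N}(0,…,0) = h`. -/
theorem chain_eq_shift
    (n N : ℕ) (hn : 1 ≤ n) (hN : 1 ≤ N)
    (A : Fin n → Fin n → ℤ)
    (hA2 : ∀ p, A p p = 2)
    (hAle : ∀ p q, p ≠ q → A p q ≤ 0)
    (hAzero : ∀ p q, A p q = 0 ↔ A q p = 0)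
    (ii : Fin N → Fin n) (h : Fin N → ℤ)
    (hH : h ∈ Hset A ii) (hpos : ∀ k, 0 ≤ h k) :
    (∀ t ≤ N, chainAux A ii (fun k => (h k).toNat) t
        = fun l : Fin N => if N - t ≤ (l : ℕ) then h l else 0) ∧
    chainAux A ii (fun k => (h k).toNat) N = h := by
  have key : ∀ t ≤ N, chainAux A ii (fun k => (h k).toNat) t
      = fun l : Fin N => if N - t ≤ (l : ℕ) then h l else 0 := by
    intro t
    induction t with
    | zero =>
      intro _
      ext l
      rw [chainAux, if_neg (by omega)]
    | succ t ih =>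
      intro ht
      have hstart : (fun l : Fin N => if N - t ≤ (l : ℕ) then h l else 0)
          = tailVec h ⟨N - 1 - t, by omega⟩ 0 := by
        ext l
        simp only [tailVec, Fin.lt_def, Fin.ext_iff]
        split_ifs <;> first | rfl | omega
      rw [chainAux, dif_pos (by omega), ih (by omega), hstart,
        ftilde_iterate_tailVec hA2 hH _ (Int.toNat_of_nonneg (hpos _)).le,
        Int.toNat_of_nonneg (hpos _)]
      ext l
      rcases eq_or_ne l ⟨N - 1 - t, by omega⟩ with rfl | hne
      · rw [if_pos (by simp only; omega)]
        simp [tailVec]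
      · rw [tailVec, if_neg hne]
        rw [Ne, Fin.ext_iff] at hne
        simp only [Fin.lt_def] at hne ⊢
        split_ifs <;> first | rfl | omega
  refine ⟨key, ?_⟩
  rw [key N le_rfl]
  simp
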